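/- For every integer p ≥ 3, every α ∈ [−1,1] and every α' ∈ ℝ with |α − α'| ≤ 1/(6p), the polynomial P_relu^(p)(α) := 1/π + α/2 + (1/π)·Σ_{i=0}^{p} (2i)!·α^{2i+2} / (2^{2i}·(i!)²·(2i+1)·(2i+2)) satisfies |P_relu^(p)(α) − P_relu^(p)(α')| ≤ |α − α'|. -/

import Mathlib

/-- the truncated Taylor polynomial `P_relu^(p)` approximating `κ1`. -/
noncomputable def Prelu (p : ℕ) (α : ℝ) : ℝ :=
  1 / Real.pi + α / 2 +
    (1 / Real.pi) * ∑ i ∈ Finset.range (p + 1),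
      (Nat.factorial (2 * i) : ℝ) * α ^ (2 * i + 2) /
        (2 ^ (2 * i) * ((Nat.factorial i : ℝ)) ^ 2 * (2 * i + 1) * (2 * i + 2))

noncomputable def cc (n : ℕ) : ℝ :=
  (Nat.factorial (2 * n) : ℝ) / (2 ^ (2 * n) * ((Nat.factorial n : ℝ)) ^ 2)

lemma cc_pos (n : ℕ) : 0 < cc n := by unfold cc; positivity

lemma cc_zero : cc 0 = 1 := by simp [cc]

lemma cc_succ (n : ℕ) : (2 * (n : ℝ) + 2) * cc (n + 1) = (2 * n + 1) * cc n := by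
  unfold cc
  have h : (Nat.factorial (2 * (n + 1)) : ℝ)
      = (2 * n + 2) * ((2 * n + 1) * (Nat.factorial (2 * n) : ℝ)) := by
    rw [show 2 * (n + 1) = (2 * n + 1) + 1 by ring, Nat.factorial_succ, Nat.factorial_succ]
    push_cast; ring
  rw [h, Nat.factorial_succ, show 2 * (n + 1) = 2 * n + 2 by ring, pow_add]
  push_cast
  field_simp

lemma cc_sq (n : ℕ) : (2 * (n : ℝ) + 1) * cc n ^ 2 ≤ 1 := by
  induction n with
  | zero => simp [cc_zero]
  | succ n ih =>
    have h := cc_succ n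
    have h2 : cc (n + 1) = (2 * n + 1) * cc n / (2 * n + 2) := by
      field_simp; linarith
    refine le_trans ?_ ih
    rw [h2]
    push_cast
    rw [div_pow, mul_div_assoc', div_le_iff₀ (by positivity)]
    have : 0 ≤ (2 * (n : ℝ) + 1) * cc n ^ 2 := by positivity
    nlinarith

lemma cc_tendsto : Filter.Tendsto cc Filter.atTop (nhds 0) := by
  have h1 : Filter.Tendsto (fun n : ℕ => Real.sqrt (1 / ((n : ℝ) + 1))) Filter.atTop (nhds 0) := by
    have := (tendsto_one_div_add_atTop_nhds_zero_nat (𝕜 := ℝ)).sqrt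
    simpa using this
  refine squeeze_zero (fun n => (cc_pos n).le) (fun n => ?_) h1
  apply Real.le_sqrt_of_sq_le
  rw [le_div_iff₀ (by positivity)]
  have := cc_sq n
  have h0 : 0 ≤ (n : ℝ) * cc n ^ 2 := by positivity
  nlinarith

noncomputable def SS (n : ℕ) (x : ℝ) : ℝ :=
  ∑ i ∈ Finset.range (n + 1), cc i / (2 * i + 1) * x ^ (2 * i + 1)
noncomputable def QQ (n : ℕ) (x : ℝ) : ℝ :=
  ∑ i ∈ Finset.range (n + 1), cc i * x ^ (2 * i)
noncomputable def QD (n : ℕ) (x : ℝ) : ℝ :=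
  ∑ i ∈ Finset.range (n + 1), cc i * (((2 * i : ℕ) : ℝ) * x ^ (2 * i - 1))

lemma SS_deriv (n : ℕ) (x : ℝ) : HasDerivAt (SS n) (QQ n x) x := by
  unfold SS QQ
  apply HasDerivAt.fun_sum
  intro i _
  refine ((hasDerivAt_pow (2 * i + 1) x).const_mul (cc i / (2 * i + 1))).congr_deriv ?_
  push_cast
  field_simp

lemma QQ_deriv (n : ℕ) (x : ℝ) : HasDerivAt (QQ n) (QD n x) x := by
  unfold QQ QD
  apply HasDerivAt.fun_sum
  intro i _
  exact (hasDerivAt_pow (2 * i) x).const_mul (cc i)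

lemma QQ_ode (n : ℕ) (s : ℝ) :
    (1 - s ^ 2) * QD n s - s * QQ n s = -((2 * n + 1) * cc n * s ^ (2 * n + 1)) := by
  induction n with
  | zero => simp [QD, QQ, cc_zero]
  | succ n ih =>
    have e1 : QD (n + 1) s = QD n s + cc (n + 1) * ((2 * n + 2) * s ^ (2 * n + 1)) := by
      unfold QD
      rw [Finset.sum_range_succ _ (n + 1)]
      rw [show 2 * (n + 1) - 1 = 2 * n + 1 by omega]
      push_cast; ring
    have e2 : QQ (n + 1) s = QQ n s + cc (n + 1) * s ^ (2 * n + 2) := by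
      unfold QQ
      rw [Finset.sum_range_succ _ (n + 1)]
      rw [show 2 * (n + 1) = 2 * n + 2 by omega]
    rw [e1, e2]
    have h := cc_succ n
    push_cast
    rw [show 2 * (n + 1) + 1 = 2 * n + 3 by ring]
    linear_combination ih + s ^ (2 * n + 1) * h

lemma QQ_zero (n : ℕ) : QQ n 0 = 1 := by
  unfold QQ
  rw [Finset.sum_eq_single 0]
  · simp [cc_zero]
  · intro b _ hb
    simp [hb]
  · simp

lemma cosQ_le (n : ℕ) (t : ℝ) (h0 : 0 ≤ t) (h1 : t ≤ Real.pi / 2) :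
    Real.cos t * QQ n (Real.sin t) ≤ 1 := by
  have hd : ∀ t, HasDerivAt (fun t => Real.cos t * QQ n (Real.sin t))
      (-((2 * n + 1) * cc n * Real.sin t ^ (2 * n + 1))) t := by
    intro t
    have := (Real.hasDerivAt_cos t).mul ((QQ_deriv n (Real.sin t)).comp t (Real.hasDerivAt_sin t))
    refine this.congr_deriv ?_
    rw [← QQ_ode, ← Real.cos_sq']
    simp only [Function.comp]
    ring
  have hanti : AntitoneOn (fun t => Real.cos t * QQ n (Real.sin t)) (Set.Icc 0 (Real.pi / 2)) := by
    apply antitoneOn_of_deriv_nonpos (convex_Icc _ _)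
    · exact fun t _ => (hd t).continuousAt.continuousWithinAt
    · exact fun t _ => (hd t).differentiableAt.differentiableWithinAt
    · intro t ht
      rw [interior_Icc] at ht
      rw [(hd t).deriv]
      have : 0 ≤ Real.sin t := Real.sin_nonneg_of_nonneg_of_le_pi ht.1.le
        (by linarith [ht.2, Real.pi_pos])
      have := cc_pos n
      have : 0 ≤ (2 * n + 1) * cc n * Real.sin t ^ (2 * n + 1) := by positivity
      linarith
  have := hanti ⟨le_rfl, by positivity⟩ ⟨h0, h1⟩ h0
  simpa [QQ_zero] using this

lemma SS_one_le (n : ℕ) : SS n 1 ≤ Real.pi / 2 := by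
  have hd : ∀ t, HasDerivAt (fun t => SS n (Real.sin t) - t)
      (Real.cos t * QQ n (Real.sin t) - 1) t := by
    intro t
    have := ((SS_deriv n (Real.sin t)).comp t (Real.hasDerivAt_sin t)).sub (hasDerivAt_id t)
    refine this.congr_deriv ?_
    ring
  have hanti : AntitoneOn (fun t => SS n (Real.sin t) - t) (Set.Icc 0 (Real.pi / 2)) := by
    apply antitoneOn_of_deriv_nonpos (convex_Icc _ _)
    · exact fun t _ => (hd t).continuousAt.continuousWithinAt
    · exact fun t _ => (hd t).differentiableAt.differentiableWithinAt
    · intro t ht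
      rw [interior_Icc] at ht
      rw [(hd t).deriv]
      linarith [cosQ_le n t ht.1.le ht.2.le]
  have hpi : (0 : ℝ) ≤ Real.pi / 2 := by positivity
  have := hanti ⟨le_rfl, hpi⟩ ⟨hpi, le_rfl⟩ hpi
  have h0 : SS n 0 = 0 := by simp [SS]
  simp [h0] at this
  linarith

lemma SS_tail (n : ℕ) (hn : 1 ≤ n) : SS n 1 + cc n / 2 ≤ Real.pi / 2 := by
  have step : ∀ m, n ≤ m → SS n 1 + cc n / 2 ≤ SS m 1 + cc m / 2 := by
    intro m hm
    induction m, hm using Nat.le_induction with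
    | base => exact le_rfl
    | succ m hm ih =>
      refine ih.trans ?_
      have e : SS (m + 1) 1 = SS m 1 + cc (m + 1) / (2 * m + 3) := by
        unfold SS
        rw [Finset.sum_range_succ _ (m + 1)]
        push_cast
        rw [one_pow, mul_one]
        ring
      rw [e]
      have h := cc_succ m
      have hm1 : (1 : ℝ) ≤ m := by exact_mod_cast hn.trans hm
      have hp := cc_pos m
      have h2 : cc m = (2 * m + 2) * cc (m + 1) / (2 * m + 1) := by
        field_simp; linarith
      have hq := cc_pos (m + 1)
      have : cc m / 2 ≤ cc (m + 1) / (2 * m + 3) + cc (m + 1) / 2 := by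
        rw [h2]
        have : cc (m + 1) / (2 * m + 3) + cc (m + 1) / 2 - (2 * m + 2) * cc (m + 1) / (2 * m + 1) / 2
          = cc (m + 1) * (2 * m - 1) / (2 * (2 * m + 3) * (2 * m + 1)) := by
          field_simp; ring
        have h3 : 0 ≤ cc (m + 1) * (2 * m - 1) / (2 * (2 * m + 3) * (2 * m + 1)) :=
          div_nonneg (mul_nonneg hq.le (by linarith)) (by positivity)
        linarith
      linarith
  have ht : Filter.Tendsto (fun m => Real.pi / 2 + cc m / 2) Filter.atTop
      (nhds (Real.pi / 2 + 0 / 2)) := (cc_tendsto.div_const 2).const_add _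
  have := ge_of_tendsto ht (b := SS n 1 + cc n / 2) (by
    filter_upwards [Filter.eventually_ge_atTop n] with m hm
    linarith [step m hm, SS_one_le m])
  simpa using this

lemma cc_sum (n : ℕ) : ∑ i ∈ Finset.range (n + 1), cc i = (2 * n + 1) * cc n := by
  have := QQ_ode n 1
  simp [QQ] at this
  linarith

lemma pow_conv (x : ℝ) (hx : 1 ≤ x) (k N : ℕ) (hk : k ≤ N) (hN : 0 < N) :
    x ^ k ≤ 1 + k / N * (x ^ N - 1) := by
  have hN' : (0 : ℝ) < N := by exact_mod_cast hN
  have h1 : 1 ≤ x ^ N := one_le_pow₀ hx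
  have := rpow_one_add_le_one_add_mul_self (s := x ^ N - 1) (by linarith)
    (p := (k : ℝ) / N) (by positivity) (by rw [div_le_one hN']; exact_mod_cast hk)
  refine le_trans (le_of_eq ?_) this
  rw [add_sub_cancel, ← Real.rpow_natCast x N, ← Real.rpow_mul (by linarith),
    mul_div_cancel₀ _ hN'.ne', Real.rpow_natCast]

lemma pow_bd (p : ℕ) (hp : 3 ≤ p) : (1 + 1 / (6 * (p : ℝ))) ^ (2 * p + 1) ≤ 3 / 2 := by
  have hp' : (3 : ℝ) ≤ p := by exact_mod_cast hp
  have h1 : 1 + 1 / (6 * (p : ℝ)) ≤ Real.exp (1 / (6 * (p : ℝ))) := by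
    linarith [Real.add_one_le_exp (1 / (6 * (p : ℝ)))]
  have h2 : (1 + 1 / (6 * (p : ℝ))) ^ (2 * p + 1) ≤ Real.exp (7 / 18) := by
    refine (pow_le_pow_left₀ (by positivity) h1 _).trans ?_
    rw [← Real.exp_nat_mul]
    apply Real.exp_le_exp.mpr
    push_cast
    rw [mul_one_div, div_le_iff₀ (by positivity)]
    linarith
  refine h2.trans ?_
  have h3 : Real.exp (7 / 18) ^ 18 = Real.exp 1 ^ 7 := by
    rw [← Real.exp_nat_mul, ← Real.exp_nat_mul]; norm_num
  refine le_of_pow_le_pow_left₀ (n := 18) (by norm_num) (by norm_num) ?_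
  rw [h3]
  refine (pow_le_pow_left₀ (Real.exp_pos 1).le Real.exp_one_lt_d9.le 7).trans ?_
  norm_num

lemma SS_bd (p : ℕ) (hp : 3 ≤ p) (x : ℝ) (hx : |x| ≤ 1 + 1 / (6 * (p : ℝ))) :
    |SS p x| ≤ Real.pi / 2 := by
  set R := 1 + 1 / (6 * (p : ℝ)) with hR
  have hR1 : 1 ≤ R := by rw [hR]; have : 0 ≤ 1 / (6 * (p : ℝ)) := by positivity
                         linarith
  have hb := pow_bd p hp
  rw [← hR] at hb
  refine le_trans ?_ (SS_tail p (by omega))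
  have key : SS p 1 + cc p / 2
      = ∑ i ∈ Finset.range (p + 1), (cc i / (2 * i + 1) + cc i * (1 / (2 * (2 * p + 1)))) := by
    rw [Finset.sum_add_distrib, ← Finset.sum_mul, cc_sum]
    simp only [SS, one_pow, mul_one]
    field_simp
  rw [key]
  refine (Finset.abs_sum_le_sum_abs _ _).trans (Finset.sum_le_sum ?_)
  intro i hi
  have hi' : i ≤ p := by simpa [Nat.lt_succ_iff] using hi
  have hc := cc_pos i
  rw [abs_mul, abs_pow, abs_of_pos (by positivity)]
  have h1 : |x| ^ (2 * i + 1) ≤ R ^ (2 * i + 1) := pow_le_pow_left₀ (abs_nonneg x) hx _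
  have h2 := pow_conv R hR1 (2 * i + 1) (2 * p + 1) (by omega) (by omega)
  have h3 : |x| ^ (2 * i + 1) ≤ 1 + (2 * i + 1) / (2 * p + 1) * (1 / 2) := by
    refine h1.trans (h2.trans ?_)
    push_cast
    have : (0 : ℝ) ≤ (2 * i + 1) / (2 * p + 1) := by positivity
    nlinarith
  refine (mul_le_mul_of_nonneg_left h3 (by positivity)).trans (le_of_eq ?_)
  field_simp

lemma Prelu_deriv (p : ℕ) (x : ℝ) :
    HasDerivAt (Prelu p) (1 / 2 + 1 / Real.pi * SS p x) x := by
  have hs : HasDerivAt (fun α : ℝ => ∑ i ∈ Finset.range (p + 1),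
      (Nat.factorial (2 * i) : ℝ) * α ^ (2 * i + 2) /
        (2 ^ (2 * i) * ((Nat.factorial i : ℝ)) ^ 2 * (2 * i + 1) * (2 * i + 2))) (SS p x) x := by
    unfold SS
    apply HasDerivAt.fun_sum
    intro i _
    refine (((hasDerivAt_pow (2 * i + 2) x).const_mul _).div_const _).congr_deriv ?_
    unfold cc
    rw [show 2 * i + 2 - 1 = 2 * i + 1 by omega]
    push_cast
    field_simp
  unfold Prelu
  exact (((hasDerivAt_id x).div_const 2).const_add _).add (hs.const_mul _)

theorem prelu_sensitivity (p : ℕ) (hp : 3 ≤ p) (α α' : ℝ)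
    (hα : α ∈ Set.Icc (-1 : ℝ) 1) (hαα' : |α - α'| ≤ 1 / (6 * (p : ℝ))) :
    |Prelu p α - Prelu p α'| ≤ |α - α'| := by
  have h0 : 0 ≤ 1 / (6 * (p : ℝ)) := by positivity
  have hab := abs_le.mp hαα'
  have := (convex_Icc (-(1 + 1 / (6 * (p : ℝ)))) (1 + 1 / (6 * (p : ℝ)))).norm_image_sub_le_of_norm_hasDerivWithin_le
    (f := Prelu p) (f' := fun x => 1 / 2 + 1 / Real.pi * SS p x) (C := 1)
    (fun x _ => (Prelu_deriv p x).hasDerivWithinAt) (fun x hx => by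
      have h := abs_le.mp (SS_bd p hp x (abs_le.mpr hx))
      have hpi := Real.pi_pos
      have e : 1 / Real.pi * SS p x = SS p x / Real.pi := by ring
      rw [Real.norm_eq_abs, abs_le, e]
      have h1 : SS p x / Real.pi ≤ 1 / 2 := by rw [div_le_iff₀ hpi]; linarith
      have h2 : -(1 / 2) ≤ SS p x / Real.pi := by rw [le_div_iff₀ hpi]; linarith
      constructor <;> linarith)
    (x := α') (y := α) ⟨by linarith [hα.1], by linarith [hα.2]⟩
    ⟨by linarith [hα.1], by linarith [hα.2]⟩
  simpa using this
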